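/- Let α, β ∈ ℝ with |α−β| < 1/2, α ≠ β, and α, β ∉ {1/2, −1/2}. For n ∈ ℤ define 𝓛_n^{α,β} on ℝ∖{0} by 𝓛_n^{α,β}(y) := Γ(1/2−n−α)^{−1}·Ψ(1/2+n+β, 1−α+β; y) for y > 0 and 𝓛_n^{α,β}(y) := Γ(1/2+n+β)^{−1}·Ψ(1/2−n−α, 1−α+β; −y) for y < 0, and define the weight μ_{α,β}(y) := |y|^{β−α} e^{−|y|}·cos(πβ) for y > 0 and μ_{α,β}(y) := |y|^{β−α} e^{−|y|}·cos(πα) for y < 0. Then the functions 𝓛_n^{α,β} are pairwise orthogonal with respect to the weight μ_{α,β}(y) dy: for m ≠ n, ∫_{−∞}^{∞} 𝓛_n^{α,β}(y)·conj(𝓛_m^{α,β}(y))·μ_{α,β}(y) dy = 0, and moreover ∫_{−∞}^{∞} |𝓛_n^{α,β}(y)|²·μ_{α,β}(y) dy = (−1)^n·π/(Γ(1/2+n+β)·Γ(1/2−n−α)). -/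

import Mathlib

open MeasureTheory Complex

/-- The Pochhammer symbol `(a)_k = a (a+1) ⋯ (a+k-1)`. -/
noncomputable def poch (a : ℂ) (k : ℕ) : ℂ := ∏ i ∈ Finset.range k, (a + i)

/-- The Kummer confluent hypergeometric function `₁F₁[a;c;x]`. -/
noncomputable def M11 (a c : ℂ) (x : ℝ) : ℂ :=
  ∑' k : ℕ, poch a k / (poch c k * (Nat.factorial k)) * (x : ℂ)^k

/-- The Tricomi confluent hypergeometric function `Ψ(a,c;x)` for `x > 0`,
with `x^{1-c} := exp((1-c)·ln x)`. -/
noncomputable def Psi (a c : ℂ) (x : ℝ) : ℂ :=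
  Complex.Gamma (1 - c) / Complex.Gamma (a - c + 1) * M11 a c x +
    Complex.Gamma (c - 1) / Complex.Gamma a *
      Complex.exp ((1 - c) * Real.log x) * M11 (a - c + 1) (2 - c) x

/-- The perturbed Laguerre functions `𝓛_n^{α,β}` for real `α, β`. -/
noncomputable def Lag (α β : ℝ) (n : ℤ) (y : ℝ) : ℂ :=
  if 0 < y then
    (Complex.Gamma (1/2 - (n : ℂ) - (α : ℂ)))⁻¹ *
      Psi (1/2 + (n : ℂ) + (β : ℂ)) (1 - (α : ℂ) + (β : ℂ)) y
  else
    (Complex.Gamma (1/2 + (n : ℂ) + (β : ℂ)))⁻¹ *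
      Psi (1/2 - (n : ℂ) - (α : ℂ)) (1 - (α : ℂ) + (β : ℂ)) (-y)

/-- The weight `μ_{α,β}`. -/
noncomputable def muW (α β : ℝ) (y : ℝ) : ℝ :=
  |y| ^ (β - α) * Real.exp (-|y|) *
    (if 0 < y then Real.cos (Real.pi * β) else Real.cos (Real.pi * α))

section

open Set Filter Topology

/-- The coefficients `(a)_k / ((c)_k k!)` of Kummer's series. -/
noncomputable def kummerCoeff (a c : ℝ) (k : ℕ) : ℝ :=
  (∏ i ∈ Finset.range k, (a + i) / (c + i)) / (Nat.factorial k)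

/-- The real Kummer function. -/
noncomputable def kummer (a c x : ℝ) : ℝ := ∑' k : ℕ, kummerCoeff a c k * x ^ k

lemma kummerCoeff_zero (a c : ℝ) : kummerCoeff a c 0 = 1 := by simp [kummerCoeff]

lemma kummerCoeff_succ (a c : ℝ) (k : ℕ) :
    kummerCoeff a c (k + 1) = kummerCoeff a c k * ((a + k) / ((c + k) * (k + 1))) := by
  simp only [kummerCoeff, Finset.prod_range_succ, Nat.factorial_succ, div_eq_mul_inv, mul_inv]
  push_cast
  rw [mul_inv]
  ring

lemma abs_kummerCoeff_le {a c L : ℝ} (hc : 0 < c) (ha : |a| ≤ L) (k : ℕ) :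
    |kummerCoeff a c k| ≤ (L / c + 1) ^ k / (Nat.factorial k) := by
  have hL : 0 ≤ L := (abs_nonneg a).trans ha
  rw [kummerCoeff, abs_div, Nat.abs_cast, Finset.abs_prod]
  gcongr
  calc ∏ i ∈ Finset.range k, |(a + i) / (c + i)|
      ≤ ∏ _i ∈ Finset.range k, (L / c + 1) := by
        refine Finset.prod_le_prod (fun _ _ => abs_nonneg _) fun i _ => ?_
        have hi : (0 : ℝ) ≤ i := Nat.cast_nonneg i
        rw [abs_div, abs_of_pos (by linarith : 0 < c + (i : ℝ)), div_le_iff₀ (by linarith)]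
        have h1 : |a + i| ≤ L + i := (abs_add_le _ _).trans (by rw [Nat.abs_cast]; linarith)
        have h2 : (L / c + 1) * (c + i) = L + c + i + L / c * i := by field_simp; ring
        have h3 : 0 ≤ L / c * i := by positivity
        linarith
    _ = (L / c + 1) ^ k := by simp

lemma abs_kummerCoeff_mul_pow_le {a c L x R : ℝ} (hc : 0 < c) (ha : |a| ≤ L) (hx : |x| ≤ R)
    (k : ℕ) : |kummerCoeff a c k * x ^ k| ≤ ((L / c + 1) * R) ^ k / (Nat.factorial k) := by
  have hL : 0 ≤ L := (abs_nonneg a).trans ha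
  rw [abs_mul, abs_pow, mul_pow, mul_div_right_comm]
  gcongr
  exact abs_kummerCoeff_le hc ha k

lemma summable_kummer (a : ℝ) {c : ℝ} (hc : 0 < c) (x : ℝ) :
    Summable fun k => kummerCoeff a c k * x ^ k :=
  Summable.of_norm_bounded (Real.summable_pow_div_factorial _)
    fun k => abs_kummerCoeff_mul_pow_le hc le_rfl le_rfl k

lemma kummerCoeff_shift (a : ℝ) {c : ℝ} (hc : 0 < c) (k : ℕ) :
    (k + 1) * kummerCoeff a c (k + 1) = a / c * kummerCoeff (a + 1) (c + 1) k := by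
  have hk : (k : ℝ) + 1 ≠ 0 := by positivity
  have h : ∏ i ∈ Finset.range (k + 1), (a + i) / (c + i)
      = a / c * ∏ i ∈ Finset.range k, (a + 1 + i) / (c + 1 + i) := by
    rw [Finset.prod_range_succ', mul_comm]
    simp only [Nat.cast_add, Nat.cast_one, Nat.cast_zero, add_zero]
    congr 1
    refine Finset.prod_congr rfl fun i _ => ?_
    ring
  rw [kummerCoeff, kummerCoeff, h, Nat.factorial_succ]
  push_cast
  field_simp

lemma hasDerivAt_kummer (a : ℝ) {c : ℝ} (hc : 0 < c) (x : ℝ) :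
    HasDerivAt (kummer a c) (a / c * kummer (a + 1) (c + 1) x) x := by
  set R := |x| + 1
  have hterm : ∀ (k : ℕ) (y : ℝ), (k + 1 : ℝ) * kummerCoeff a c (k + 1) * y ^ k
      = a / c * (kummerCoeff (a + 1) (c + 1) k * y ^ k) := fun k y => by
    rw [kummerCoeff_shift a hc, mul_assoc]
  have hsum : ∀ L : ℝ, Summable fun k : ℕ =>
      |a / c| * (((L / (c + 1) + 1) * R) ^ k / (Nat.factorial k)) := fun L =>
    (Real.summable_pow_div_factorial _).mul_left _
  have h0 : ∀ y, kummer a c y = 1 + ∑' k : ℕ, kummerCoeff a c (k + 1) * y ^ (k + 1) := fun y => by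
    rw [kummer, (summable_kummer a hc y).tsum_eq_zero_add]
    simp [kummerCoeff_zero]
  have key : HasDerivAt (fun y => ∑' k : ℕ, kummerCoeff a c (k + 1) * y ^ (k + 1))
      (∑' k : ℕ, (k + 1 : ℝ) * kummerCoeff a c (k + 1) * x ^ k) x := by
    refine hasDerivAt_tsum_of_isPreconnected (t := Ioo (-R) R)
      (g' := fun (k : ℕ) (y : ℝ) => (k + 1 : ℝ) * kummerCoeff a c (k + 1) * y ^ k)
      (hsum |a + 1|) isOpen_Ioo isPreconnected_Ioo ?_ ?_ (y₀ := 0) ?_ ?_ ?_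
    · intro k y _
      have := (hasDerivAt_pow (k + 1) y).const_mul (kummerCoeff a c (k + 1))
      refine this.congr_deriv ?_
      push_cast
      ring
    · intro k y hy
      rw [hterm, Real.norm_eq_abs, abs_mul]
      gcongr
      exact abs_kummerCoeff_mul_pow_le (by linarith) le_rfl (abs_le.2 ⟨hy.1.le, hy.2.le⟩) k
    · have : 0 ≤ |x| := abs_nonneg x
      constructor <;> simp only [R] <;> linarith
    · exact (summable_nat_add_iff (f := fun k => kummerCoeff a c k * (0 : ℝ) ^ k) 1).2
        (summable_kummer a hc 0)
    · exact abs_lt.1 (by simp [R])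
  have : kummer a c = fun y => 1 + ∑' k : ℕ, kummerCoeff a c (k + 1) * y ^ (k + 1) := funext h0
  rw [this]
  refine (key.const_add 1).congr_deriv ?_
  rw [kummer, ← tsum_mul_left]
  exact tsum_congr fun k => hterm k x

lemma continuous_kummer (a : ℝ) {c : ℝ} (hc : 0 < c) : Continuous (kummer a c) :=
  continuous_iff_continuousAt.2 fun x => (hasDerivAt_kummer a hc x).continuousAt

lemma continuous_kummer_left {c : ℝ} (hc : 0 < c) (x : ℝ) : Continuous fun a => kummer a c x := by
  refine continuous_iff_continuousAt.2 fun a₀ => ?_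
  have : ContinuousOn (fun a => kummer a c x) (Ioo (-(|a₀| + 1)) (|a₀| + 1)) := by
    refine continuousOn_tsum (u := fun k => (((|a₀| + 1) / c + 1) * |x|) ^ k / (Nat.factorial k))
      (fun k => ?_) (Real.summable_pow_div_factorial _) fun k a ha =>
        abs_kummerCoeff_mul_pow_le hc (abs_le.2 ⟨ha.1.le, ha.2.le⟩) le_rfl k
    unfold kummerCoeff
    fun_prop
  exact this.continuousAt (Ioo_mem_nhds (abs_lt.1 (by simp)).1 (abs_lt.1 (by simp)).2)

lemma kummer_zero (a c : ℝ) : kummer a c 0 = 1 := by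
  rw [kummer, tsum_eq_single 0 fun k hk => by simp [hk]]
  simp [kummerCoeff_zero]

lemma one_le_kummer {a c x : ℝ} (ha : 0 < a) (hc : 0 < c) (hx : 0 ≤ x) : 1 ≤ kummer a c x := by
  have hnn : ∀ k, 0 ≤ kummerCoeff a c k * x ^ k := fun k => by
    unfold kummerCoeff
    refine mul_nonneg (div_nonneg (Finset.prod_nonneg fun i _ => ?_) (by positivity))
      (by positivity)
    positivity
  have := (summable_kummer a hc x).le_tsum 0 fun k _ => hnn k
  rw [kummerCoeff_zero, pow_zero, mul_one] at this
  exact this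

lemma kummerCoeff_succ_param (a c : ℝ) (k : ℕ) :
    a * kummerCoeff (a + 1) c k = (a + k) * kummerCoeff a c k := by
  induction k with
  | zero => simp [kummerCoeff_zero]
  | succ k ih =>
    rw [kummerCoeff_succ, kummerCoeff_succ]
    push_cast
    linear_combination ((a + 1 + k) / ((c + k) * (k + 1))) * ih

/-- Raising the first parameter: `(x d/dx + a) M(a) = a M(a+1)`. -/
lemma kummer_raise (a : ℝ) {c : ℝ} (hc : 0 < c) (x : ℝ) :
    x * (a / c * kummer (a + 1) (c + 1) x) = a * kummer (a + 1) c x - a * kummer a c x := by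
  have h1 : a * kummer (a + 1) c x - a * kummer a c x
      = ∑' k : ℕ, (k : ℝ) * kummerCoeff a c k * x ^ k := by
    rw [kummer, kummer, ← tsum_mul_left, ← tsum_mul_left,
      ← ((summable_kummer (a + 1) hc x).mul_left a).tsum_sub ((summable_kummer a hc x).mul_left a)]
    refine tsum_congr fun k => ?_
    linear_combination x ^ k * kummerCoeff_succ_param a c k
  have hs : Summable fun k : ℕ => (k : ℝ) * kummerCoeff a c k * x ^ k := by
    refine (((summable_kummer (a + 1) hc x).mul_left a).sub
      ((summable_kummer a hc x).mul_left a)).congr fun k => ?_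
    linear_combination x ^ k * kummerCoeff_succ_param a c k
  rw [h1, hs.tsum_eq_zero_add, kummer, ← tsum_mul_left, ← tsum_mul_left]
  simp only [Nat.cast_zero, zero_mul, zero_add]
  refine tsum_congr fun k => ?_
  have := kummerCoeff_shift a hc k
  push_cast
  linear_combination -x ^ (k + 1) * this

/-- Gauss's contiguous relation in the first parameter. -/
lemma kummer_contiguous (a : ℝ) {c : ℝ} (hc : 0 < c) (x : ℝ) :
    (c - a) * kummer (a - 1) c x + (2 * a - c + x) * kummer a c x - a * kummer (a + 1) c x = 0 := by
  have h2 : (c - a) * kummer (a - 1) c x + (2 * a - c) * kummer a c x - a * kummer (a + 1) c x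
      = ∑' k : ℕ, ((c - a) * kummerCoeff (a - 1) c k + (2 * a - c) * kummerCoeff a c k
        - a * kummerCoeff (a + 1) c k) * x ^ k := by
    rw [kummer, kummer, kummer, ← tsum_mul_left, ← tsum_mul_left, ← tsum_mul_left,
      ← ((summable_kummer (a - 1) hc x).mul_left (c - a)).tsum_add
        ((summable_kummer a hc x).mul_left (2 * a - c)),
      ← Summable.tsum_sub (((summable_kummer (a - 1) hc x).mul_left (c - a)).add
        ((summable_kummer a hc x).mul_left (2 * a - c)))
        ((summable_kummer (a + 1) hc x).mul_left a)]
    exact tsum_congr fun k => by ring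
  have hs : Summable fun k : ℕ => ((c - a) * kummerCoeff (a - 1) c k
      + (2 * a - c) * kummerCoeff a c k - a * kummerCoeff (a + 1) c k) * x ^ k := by
    refine ((((summable_kummer (a - 1) hc x).mul_left (c - a)).add
        ((summable_kummer a hc x).mul_left (2 * a - c))).sub
        ((summable_kummer (a + 1) hc x).mul_left a)).congr fun k => ?_
    ring
  have hcoef : ∀ k : ℕ, (c - a) * kummerCoeff (a - 1) c (k + 1)
      + (2 * a - c) * kummerCoeff a c (k + 1) - a * kummerCoeff (a + 1) c (k + 1)
      = - kummerCoeff a c k := fun k => by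
    have e1 := kummerCoeff_succ_param a c (k + 1)
    have e2 := kummerCoeff_succ_param (a - 1) c k
    rw [sub_add_cancel] at e2
    have hk : (k : ℝ) + 1 ≠ 0 := by positivity
    have hck : c + (k : ℝ) ≠ 0 := by positivity
    rw [e1, kummerCoeff_succ, kummerCoeff_succ]
    push_cast
    field_simp
    linear_combination (-(c - a)) * e2
  have h3 : x * kummer a c x = ∑' k : ℕ, kummerCoeff a c k * x ^ (k + 1) := by
    rw [kummer, ← tsum_mul_left]
    exact tsum_congr fun k => by ring
  have h4 : (c - a) * kummer (a - 1) c x + (2 * a - c) * kummer a c x - a * kummer (a + 1) c x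
      = - (x * kummer a c x) := by
    rw [h2, hs.tsum_eq_zero_add, h3, ← tsum_neg]
    simp only [kummerCoeff_zero, hcoef]
    simp
    ring
  linear_combination h4

/-- `f` solves Kummer's equation with parameters `a`, `c` on `(0, ∞)`, with Euler derivative `f₁`. -/
structure IsKummerSol (a c : ℝ) (f f₁ : ℝ → ℝ) : Prop where
  hasDerivAt : ∀ x, 0 < x → HasDerivAt f (f₁ x / x) x
  hasDerivAt_theta : ∀ x, 0 < x → HasDerivAt f₁ (((1 - c + x) * f₁ x + a * x * f x) / x) x

/-- The weighted Wronskian of two functions with Euler derivatives `f₁` and `g₁`. -/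
noncomputable def kummerWronskian (c : ℝ) (f f₁ g g₁ : ℝ → ℝ) (x : ℝ) : ℝ :=
  x ^ (c - 1) * Real.exp (-x) * (f₁ x * g x - f x * g₁ x)

namespace IsKummerSol

variable {a b c : ℝ} {f f₁ g g₁ : ℝ → ℝ}

lemma add (hf : IsKummerSol a c f f₁) (hg : IsKummerSol a c g g₁) :
    IsKummerSol a c (fun x => f x + g x) (fun x => f₁ x + g₁ x) where
  hasDerivAt x hx := ((hf.hasDerivAt x hx).add (hg.hasDerivAt x hx)).congr_deriv (by ring)
  hasDerivAt_theta x hx :=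
    ((hf.hasDerivAt_theta x hx).add (hg.hasDerivAt_theta x hx)).congr_deriv (by ring)

lemma const_mul (r : ℝ) (hf : IsKummerSol a c f f₁) :
    IsKummerSol a c (fun x => r * f x) (fun x => r * f₁ x) where
  hasDerivAt x hx := ((hf.hasDerivAt x hx).const_mul r).congr_deriv (by ring)
  hasDerivAt_theta x hx := ((hf.hasDerivAt_theta x hx).const_mul r).congr_deriv (by ring)

/-- Multiplication by `x ^ (1 - c)` maps solutions for `(a - c + 1, 2 - c)` to solutions for
`(a, c)`. -/
lemma rpow_mul (hf : IsKummerSol (a - c + 1) (2 - c) f f₁) :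
    IsKummerSol a c (fun x => x ^ (1 - c) * f x)
      (fun x => x ^ (1 - c) * ((1 - c) * f x + f₁ x)) where
  hasDerivAt x hx := by
    have h := (Real.hasDerivAt_rpow_const (p := 1 - c) (Or.inl hx.ne')).mul (hf.hasDerivAt x hx)
    refine h.congr_deriv ?_
    rw [Real.rpow_sub_one hx.ne']
    field_simp
  hasDerivAt_theta x hx := by
    have h := (Real.hasDerivAt_rpow_const (p := 1 - c) (Or.inl hx.ne')).mul
      (((hf.hasDerivAt x hx).const_mul (1 - c)).add (hf.hasDerivAt_theta x hx))
    refine h.congr_deriv ?_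
    simp only [Pi.add_apply]
    rw [Real.rpow_sub_one hx.ne']
    field_simp
    ring

/-- Lagrange's identity for Kummer's equation. -/
lemma hasDerivAt_wronskian (hf : IsKummerSol a c f f₁) (hg : IsKummerSol b c g g₁) {x : ℝ}
    (hx : 0 < x) : HasDerivAt (kummerWronskian c f f₁ g g₁)
      ((a - b) * (f x * g x * (x ^ (c - 1) * Real.exp (-x)))) x := by
  have h := ((Real.hasDerivAt_rpow_const (p := c - 1) (Or.inl hx.ne')).mul
    (hasDerivAt_neg x).exp).mul
      (((hf.hasDerivAt_theta x hx).mul (hg.hasDerivAt x hx)).sub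
        ((hf.hasDerivAt x hx).mul (hg.hasDerivAt_theta x hx)))
  refine h.congr_deriv ?_
  simp only [Pi.mul_apply, Pi.sub_apply]
  rw [Real.rpow_sub_one hx.ne']
  field_simp
  ring

end IsKummerSol

lemma eq_of_hasDerivAt_zero_of_tendsto {f : ℝ → ℝ} {l : ℝ} (hf : ∀ x, 0 < x → HasDerivAt f 0 x)
    (hl : Tendsto f (𝓝[>] 0) (𝓝 l)) {x : ℝ} (hx : 0 < x) : f x = l := by
  have hc : ∀ y ∈ Ioi (0 : ℝ), f y = f x := fun y hy =>
    isOpen_Ioi.is_const_of_deriv_eq_zero isPreconnected_Ioi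
      (fun z hz => (hf z hz).differentiableAt.differentiableWithinAt)
      (fun z hz => (hf z hz).deriv) hy hx
  refine tendsto_nhds_unique (tendsto_const_nhds.congr' ?_) hl
  filter_upwards [self_mem_nhdsWithin] with y hy using (hc y hy).symm

lemma isKummerSol_kummer (a : ℝ) {c : ℝ} (hc : 0 < c) :
    IsKummerSol a c (kummer a c) (fun x => a * kummer (a + 1) c x - a * kummer a c x) := by
  have h1 : ∀ b x, 0 < x → HasDerivAt (kummer b c)
      ((b * kummer (b + 1) c x - b * kummer b c x) / x) x := fun b x hx => by
    rw [← kummer_raise b hc, mul_div_cancel_left₀ _ hx.ne']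
    exact hasDerivAt_kummer b hc x
  refine ⟨h1 a, fun x hx => ?_⟩
  refine (((h1 (a + 1) x hx).const_mul a).sub ((h1 a x hx).const_mul a)).congr_deriv ?_
  have h := kummer_contiguous (a + 1) hc x
  rw [add_sub_cancel_right] at h
  field_simp
  linear_combination (-a) * h

lemma tendsto_rpow_nhdsGT_zero {p : ℝ} (hp : 0 < p) :
    Tendsto (fun x : ℝ => x ^ p) (𝓝[>] 0) (𝓝 0) := by
  have := (Real.continuousAt_rpow_const 0 p (Or.inr hp.le)).tendsto
  rw [Real.zero_rpow hp.ne'] at this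
  exact this.mono_left nhdsWithin_le_nhds

lemma tendsto_kummer_nhdsGT_zero (a : ℝ) {c : ℝ} (hc : 0 < c) :
    Tendsto (kummer a c) (𝓝[>] 0) (𝓝 1) := by
  have := (continuous_kummer a hc).tendsto 0
  rw [kummer_zero] at this
  exact this.mono_left nhdsWithin_le_nhds

/-- A solution with vanishing boundary data at the origin vanishes. -/
lemma IsKummerSol.eq_zero {a c : ℝ} {f f₁ : ℝ → ℝ} (hf : IsKummerSol a c f f₁) (ha : 0 < a)
    (hc : 0 < c) (h0 : Tendsto f (𝓝[>] 0) (𝓝 0))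
    (h1 : Tendsto (fun x => x ^ (c - 1) * f₁ x) (𝓝[>] 0) (𝓝 0)) {x : ℝ} (hx : 0 < x) :
    f x = 0 := by
  have hM := isKummerSol_kummer a hc
  set g₁ := fun x => a * kummer (a + 1) c x - a * kummer a c x with hg₁
  have hexp : Tendsto (fun x : ℝ => Real.exp (-x)) (𝓝[>] 0) (𝓝 1) := by
    have : Continuous fun x : ℝ => Real.exp (-x) := by fun_prop
    have := this.tendsto 0
    rw [neg_zero, Real.exp_zero] at this
    exact this.mono_left nhdsWithin_le_nhds
  have hlim : Tendsto (kummerWronskian c f f₁ (kummer a c) g₁) (𝓝[>] 0) (𝓝 0) := by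
    have hk := tendsto_kummer_nhdsGT_zero a hc
    have hk' := tendsto_kummer_nhdsGT_zero (a + 1) (c := c + 1) (by linarith)
    have := hexp.mul ((h1.mul hk).sub (((h0.mul (tendsto_rpow_nhdsGT_zero hc)).mul
      (hk'.const_mul (a / c)))))
    have h2 := this.congr' (f₂ := kummerWronskian c f f₁ (kummer a c) g₁) (by
      filter_upwards [self_mem_nhdsWithin] with y hy
      have hy' : (0 : ℝ) < y := hy
      simp only [kummerWronskian, hg₁]
      rw [← kummer_raise a hc, Real.rpow_sub_one hy'.ne']
      field_simp)
    simpa using h2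
  have hW : ∀ y, 0 < y → kummerWronskian c f f₁ (kummer a c) g₁ y = 0 := fun y hy =>
    eq_of_hasDerivAt_zero_of_tendsto (fun z hz => by
      simpa using hf.hasDerivAt_wronskian hM hz) hlim hy
  have hpos : ∀ y, 0 < y → kummer a c y ≠ 0 := fun y hy =>
    (zero_lt_one.trans_le (one_le_kummer ha hc hy.le)).ne'
  have hq : f x / kummer a c x = 0 := by
    refine eq_of_hasDerivAt_zero_of_tendsto (f := fun y => f y / kummer a c y) (fun y hy => ?_) ?_ hx
    · refine ((hf.hasDerivAt y hy).div (hM.hasDerivAt y hy) (hpos y hy)).congr_deriv ?_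
      have h := hW y hy
      rw [kummerWronskian, mul_eq_zero, or_iff_right (by positivity)] at h
      rw [div_eq_zero_iff]
      left
      field_simp
      linear_combination h
    · have h := h0.div (tendsto_kummer_nhdsGT_zero a hc) one_ne_zero
      rwa [zero_div] at h
  exact (div_eq_zero_iff.1 hq).resolve_right (hpos x hx)

/-- The integral `∫₀^∞ e^{-xt} t^{p-1} (1+t)^q dt`. -/
noncomputable def tricomiIntegral (p q x : ℝ) : ℝ :=
  ∫ t in Ioi (0 : ℝ), Real.exp (-(x * t)) * (t ^ (p - 1) * (1 + t) ^ q)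

lemma integrableOn_rpow_mul_exp_neg_mul {p x : ℝ} (hp : 0 < p) (hx : 0 < x) :
    IntegrableOn (fun t : ℝ => t ^ (p - 1) * Real.exp (-(x * t))) (Ioi 0) := by
  have := integrableOn_rpow_mul_exp_neg_mul_rpow (s := p - 1) (by linarith) one_pos hx
  simpa [neg_mul] using this

lemma one_add_rpow_le_one {t q : ℝ} (ht : 0 < t) (hq : q ≤ 0) : (1 + t) ^ q ≤ 1 :=
  Real.rpow_le_one_of_one_le_of_nonpos (by linarith) hq

lemma norm_tricomi_integrand {p q x t : ℝ} (ht : 0 < t) :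
    ‖Real.exp (-(x * t)) * (t ^ (p - 1) * (1 + t) ^ q)‖
      = Real.exp (-(x * t)) * (t ^ (p - 1) * (1 + t) ^ q) :=
  Real.norm_of_nonneg (by positivity)

lemma integrableOn_tricomi {p q x : ℝ} (hp : 0 < p) (hq : q ≤ 0) (hx : 0 < x) :
    IntegrableOn (fun t : ℝ => Real.exp (-(x * t)) * (t ^ (p - 1) * (1 + t) ^ q)) (Ioi 0) := by
  refine Integrable.mono' (integrableOn_rpow_mul_exp_neg_mul hp hx)
    (Measurable.aestronglyMeasurable (by fun_prop)) ?_
  refine (ae_restrict_iff' measurableSet_Ioi).2 (ae_of_all _ fun t (ht : 0 < t) => ?_)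
  rw [norm_tricomi_integrand ht, mul_comm]
  gcongr
  exact mul_le_of_le_one_right (by positivity) (one_add_rpow_le_one ht hq)

lemma hasDerivAt_tricomiIntegral {p q x : ℝ} (hp : 0 < p) (hq : q ≤ 0) (hx : 0 < x) :
    HasDerivAt (tricomiIntegral p q) (-tricomiIntegral (p + 1) q x) x := by
  have h := hasDerivAt_integral_of_dominated_loc_of_deriv_le (μ := volume.restrict (Ioi (0 : ℝ)))
    (F := fun y t => Real.exp (-(y * t)) * (t ^ (p - 1) * (1 + t) ^ q))
    (F' := fun y t => -(Real.exp (-(y * t)) * (t ^ (p + 1 - 1) * (1 + t) ^ q)))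
    (bound := fun t => Real.exp (-(x / 2 * t)) * (t ^ (p + 1 - 1) * (1 + t) ^ q))
    (Ioi_mem_nhds (by linarith : x / 2 < x))
    (Eventually.of_forall fun y => Measurable.aestronglyMeasurable (by fun_prop))
    (integrableOn_tricomi hp hq hx)
    (Measurable.aestronglyMeasurable (by fun_prop))
    ((ae_restrict_iff' measurableSet_Ioi).2 (ae_of_all _ fun t (ht : 0 < t) y hy => ?_))
    (integrableOn_tricomi (by linarith) hq (by linarith))
    ((ae_restrict_iff' measurableSet_Ioi).2 (ae_of_all _ fun t (ht : 0 < t) y hy => ?_))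
  · rw [integral_neg] at h
    exact h.2
  · rw [norm_neg, norm_tricomi_integrand ht]
    have hy' : x / 2 < y := hy
    gcongr
  · refine (((hasDerivAt_id y).mul_const t).fun_neg.exp.mul_const _).congr_deriv ?_
    have e : t ^ (p + 1 - 1) = t ^ (p - 1) * t := by
      rw [← Real.rpow_add_one ht.ne']; ring_nf
    rw [e]
    simp only [id]
    ring

lemma tricomiIntegral_contiguous {p q x : ℝ} (hp : 0 < p) (hq : q ≤ 0) (hx : 0 < x) :
    x * tricomiIntegral (p + 2) q x
      = p * tricomiIntegral p q x + (p + q + 1 - x) * tricomiIntegral (p + 1) q x := by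
  have i0 := integrableOn_tricomi (p := p) hp hq hx
  have i1 := integrableOn_tricomi (p := p + 1) (by linarith) hq hx
  have i2 := integrableOn_tricomi (p := p + 2) (by linarith) hq hx
  have e1 : ∀ t : ℝ, 0 < t → t ^ (p + 1 - 1) = t ^ (p - 1) * t := fun t ht => by
    rw [← Real.rpow_add_one ht.ne']; ring_nf
  have e2 : ∀ t : ℝ, 0 < t → t ^ (p + 2 - 1) = t ^ (p - 1) * t * t := fun t ht => by
    rw [← Real.rpow_add_one ht.ne', ← Real.rpow_add_one ht.ne']; ring_nf
  set f : ℝ → ℝ := fun t => Real.exp (-(x * t)) * (t ^ p * (1 + t) ^ (q + 1))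
  set f' : ℝ → ℝ := fun t =>
    p * (Real.exp (-(x * t)) * (t ^ (p - 1) * (1 + t) ^ q))
    + (p + q + 1 - x) * (Real.exp (-(x * t)) * (t ^ (p + 1 - 1) * (1 + t) ^ q))
    - x * (Real.exp (-(x * t)) * (t ^ (p + 2 - 1) * (1 + t) ^ q)) with hf'
  have hderiv : ∀ t ∈ Ioi (0 : ℝ), HasDerivAt f (f' t) t := fun t (ht : 0 < t) => by
    have hE : HasDerivAt (fun t => Real.exp (-(x * t))) (Real.exp (-(x * t)) * -x) t := by
      simpa using ((hasDerivAt_id t).const_mul x).fun_neg.exp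
    have h2 : HasDerivAt (fun t : ℝ => (1 + t) ^ (q + 1)) ((q + 1) * (1 + t) ^ q) t := by
      have := ((hasDerivAt_id t).const_add 1).rpow_const (p := q + 1)
        (Or.inl (by simp only [id]; linarith))
      simpa using this
    refine (hE.mul ((Real.hasDerivAt_rpow_const (p := p) (Or.inl ht.ne')).mul h2)).congr_deriv ?_
    simp only [hf', Pi.mul_apply]
    rw [e1 t ht, e2 t ht, Real.rpow_add_one (by linarith : 1 + t ≠ 0),
      show t ^ p = t ^ (p - 1) * t by rw [← Real.rpow_add_one ht.ne']; ring_nf]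
    ring
  have hfi : IntegrableOn f (Ioi 0) := by
    refine (i1.add i2).congr_fun (fun t (ht : 0 < t) => ?_) measurableSet_Ioi
    simp only [f, Pi.add_apply]
    rw [e1 t ht, e2 t ht, Real.rpow_add_one (by linarith : 1 + t ≠ 0),
      show t ^ p = t ^ (p - 1) * t by rw [← Real.rpow_add_one ht.ne']; ring_nf]
    ring
  have hf'i : IntegrableOn f' (Ioi 0) :=
    ((i0.const_mul p).add (i1.const_mul (p + q + 1 - x))).sub (i2.const_mul x)
  have hcont : ContinuousWithinAt f (Ici 0) 0 := by
    refine ContinuousAt.continuousWithinAt ?_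
    have h1 : ContinuousAt (fun t : ℝ => t ^ p) 0 := Real.continuousAt_rpow_const 0 p (Or.inr hp.le)
    have h2 : ContinuousAt (fun t : ℝ => (1 + t) ^ (q + 1)) 0 :=
      ContinuousAt.rpow_const (by fun_prop) (Or.inl (by norm_num))
    exact ContinuousAt.mul (by fun_prop) (h1.mul h2)
  have key := integral_Ioi_of_hasDerivAt_of_tendsto hcont hderiv hf'i
    (tendsto_zero_of_hasDerivAt_of_integrableOn_Ioi hderiv hf'i hfi)
  have hf0 : f 0 = 0 := by simp [f, Real.zero_rpow hp.ne']
  have i01 : IntegrableOn (fun t => p * (Real.exp (-(x * t)) * (t ^ (p - 1) * (1 + t) ^ q))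
      + (p + q + 1 - x) * (Real.exp (-(x * t)) * (t ^ (p + 1 - 1) * (1 + t) ^ q))) (Ioi 0) :=
    (i0.const_mul p).add (i1.const_mul (p + q + 1 - x))
  rw [hf0, sub_zero, hf', integral_sub i01 (i2.const_mul x),
    integral_add (i0.const_mul p) (i1.const_mul (p + q + 1 - x)), integral_const_mul,
    integral_const_mul, integral_const_mul] at key
  simp only [tricomiIntegral]
  linear_combination -key

lemma isKummerSol_tricomiIntegral {a c : ℝ} (ha : 0 < a) (hq : c - a - 1 ≤ 0) :
    IsKummerSol a c (tricomiIntegral a (c - a - 1))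
      (fun x => -(x * tricomiIntegral (a + 1) (c - a - 1) x)) where
  hasDerivAt x hx := (hasDerivAt_tricomiIntegral ha hq hx).congr_deriv (by field_simp)
  hasDerivAt_theta x hx := by
    refine ((hasDerivAt_id x).mul
      (hasDerivAt_tricomiIntegral (by linarith : 0 < a + 1) hq hx)).fun_neg.congr_deriv ?_
    have h := tricomiIntegral_contiguous ha hq hx
    rw [show a + 1 + 1 = a + 2 by ring]
    simp only [id]
    field_simp
    linear_combination h

/-- The beta integral of the second kind. -/
lemma betaPrime_integral {a r : ℝ} (ha : 0 < a) (har : a < r) :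
    IntegrableOn (fun t : ℝ => t ^ (a - 1) * (1 + t) ^ (-r)) (Ioi 0) ∧
    ∫ t in Ioi (0 : ℝ), t ^ (a - 1) * (1 + t) ^ (-r)
      = Real.Gamma a * Real.Gamma (r - a) / Real.Gamma r := by
  have hr : 0 < r := ha.trans har
  have hG := Real.Gamma_pos_of_pos hr
  set f : ℝ → ℝ → ℝ := fun t s => t ^ (a - 1) * (s ^ (r - 1) * Real.exp (-((1 + t) * s)))
  have hsplit : ∀ t s, f t s
      = s ^ (r - 1) * Real.exp (-(1 * s)) * (t ^ (a - 1) * Real.exp (-(s * t))) := fun t s => by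
    simp only [f]
    rw [show -((1 + t) * s) = -(1 * s) + -(s * t) by ring, Real.exp_add]
    ring
  have hinner : ∀ s, 0 < s → ∫ t in Ioi (0 : ℝ), f t s
      = Real.Gamma a * (s ^ (r - a - 1) * Real.exp (-(1 * s))) := fun s hs => by
    simp_rw [hsplit]
    rw [integral_const_mul, Real.integral_rpow_mul_exp_neg_mul_Ioi ha hs, one_div,
      Real.inv_rpow hs.le, show r - a - 1 = (r - 1) - a by ring, Real.rpow_sub hs (r - 1) a]
    field_simp
  have hinner' : ∀ t, 0 < t → ∫ s in Ioi (0 : ℝ), f t s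
      = Real.Gamma r * (t ^ (a - 1) * (1 + t) ^ (-r)) := fun t ht => by
    simp only [f]
    rw [integral_const_mul, Real.integral_rpow_mul_exp_neg_mul_Ioi hr (by linarith : 0 < 1 + t),
      one_div, Real.inv_rpow (by linarith), Real.rpow_neg (by linarith)]
    ring
  have hfi : Integrable (Function.uncurry f)
      ((volume.restrict (Ioi (0 : ℝ))).prod (volume.restrict (Ioi (0 : ℝ)))) := by
    have hm : Measurable (Function.uncurry f) := by
      unfold Function.uncurry
      fun_prop
    refine (integrable_prod_iff' hm.aestronglyMeasurable).2 ⟨?_, ?_⟩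
    · refine (ae_restrict_iff' measurableSet_Ioi).2 (ae_of_all _ fun s (hs : 0 < s) => ?_)
      simp only [Function.uncurry, hsplit]
      exact (integrableOn_rpow_mul_exp_neg_mul ha hs).const_mul _
    · refine ((integrableOn_rpow_mul_exp_neg_mul (p := r - a) (by linarith) one_pos).const_mul
        (Real.Gamma a)).congr ?_
      refine (ae_restrict_iff' measurableSet_Ioi).2 (ae_of_all _ fun s (hs : 0 < s) => ?_)
      simp only
      rw [← hinner s hs]
      refine setIntegral_congr_fun measurableSet_Ioi fun t (ht : 0 < t) => ?_
      exact (Real.norm_of_nonneg (by simp only [f]; positivity)).symm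
  have h1 : IntegrableOn (fun t : ℝ => Real.Gamma r * (t ^ (a - 1) * (1 + t) ^ (-r))) (Ioi 0) :=
    hfi.integral_prod_left.congr ((ae_restrict_iff' measurableSet_Ioi).2
      (ae_of_all _ fun t ht => hinner' t ht))
  have hI : IntegrableOn (fun t : ℝ => t ^ (a - 1) * (1 + t) ^ (-r)) (Ioi 0) := by
    refine (h1.const_mul (Real.Gamma r)⁻¹).congr (ae_of_all _ fun t => ?_)
    field_simp
  refine ⟨hI, ?_⟩
  have h2 := integral_integral_swap hfi
  rw [setIntegral_congr_fun measurableSet_Ioi fun t ht => hinner' t ht,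
    setIntegral_congr_fun measurableSet_Ioi fun s hs => hinner s hs, integral_const_mul,
    integral_const_mul, Real.integral_rpow_mul_exp_neg_mul_Ioi (by linarith) one_pos] at h2
  rw [eq_div_iff hG.ne', mul_comm, h2]
  simp

lemma tricomiIntegral_le {a c x : ℝ} (ha : 0 < a) (hc : c < 1) (hx : 0 < x) :
    tricomiIntegral a (c - a - 1) x
      ≤ Real.Gamma a * Real.Gamma (1 - c) / Real.Gamma (a - c + 1) := by
  have hb := betaPrime_integral ha (by linarith : a < a - c + 1)
  rw [show -(a - c + 1) = c - a - 1 by ring, show a - c + 1 - a = 1 - c by ring] at hb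
  rw [← hb.2]
  refine setIntegral_mono_on (integrableOn_tricomi ha (by linarith) hx) hb.1 measurableSet_Ioi
    fun t (ht : 0 < t) => ?_
  refine mul_le_of_le_one_left (by positivity) (Real.exp_le_one_iff.2 ?_)
  have := mul_pos hx ht
  linarith

lemma tricomiIntegral_nonneg (p q x : ℝ) : 0 ≤ tricomiIntegral p q x :=
  setIntegral_nonneg measurableSet_Ioi fun t (ht : 0 < t) => by positivity

lemma tendsto_tricomiIntegral_zero {a c : ℝ} (ha : 0 < a) (hc : c < 1) :
    Tendsto (tricomiIntegral a (c - a - 1)) (𝓝[>] 0)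
      (𝓝 (Real.Gamma a * Real.Gamma (1 - c) / Real.Gamma (a - c + 1))) := by
  have hb := betaPrime_integral ha (by linarith : a < a - c + 1)
  rw [show -(a - c + 1) = c - a - 1 by ring, show a - c + 1 - a = 1 - c by ring] at hb
  rw [← hb.2]
  refine tendsto_integral_filter_of_dominated_convergence _
    (Eventually.of_forall fun y => Measurable.aestronglyMeasurable (by fun_prop)) ?_ hb.1 ?_
  · filter_upwards [self_mem_nhdsWithin] with x hx
    refine (ae_restrict_iff' measurableSet_Ioi).2 (ae_of_all _ fun t (ht : 0 < t) => ?_)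
    rw [norm_tricomi_integrand ht]
    refine mul_le_of_le_one_left (by positivity) (Real.exp_le_one_iff.2 ?_)
    have := mul_pos hx ht
    linarith
  · refine ae_of_all _ fun t => ?_
    have : Continuous fun x : ℝ => Real.exp (-(x * t)) * (t ^ (a - 1) * (1 + t) ^ (c - a - 1)) := by
      fun_prop
    simpa using (this.tendsto 0).mono_left nhdsWithin_le_nhds

lemma tendsto_rpow_mul_tricomiIntegral {a c : ℝ} (hc0 : 0 < c)
    (hq : c - a - 1 ≤ 0) :
    Tendsto (fun x => x ^ c * tricomiIntegral (a + 1) (c - a - 1) x) (𝓝[>] 0)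
      (𝓝 (Real.Gamma c)) := by
  have hscale : ∀ x : ℝ, 0 < x → ∫ u in Ioi (0 : ℝ), Real.exp (-u) * (u ^ a * (x + u) ^ (c - a - 1))
      = x ^ c * tricomiIntegral (a + 1) (c - a - 1) x := fun x hx => by
    have h := integral_comp_mul_left_Ioi
      (fun u => Real.exp (-u) * (u ^ a * (x + u) ^ (c - a - 1))) 0 hx
    rw [mul_zero, smul_eq_mul, eq_inv_mul_iff_mul_eq₀ hx.ne'] at h
    rw [← h, tricomiIntegral, ← integral_const_mul, ← integral_const_mul]
    refine setIntegral_congr_fun measurableSet_Ioi fun t (ht : 0 < t) => ?_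
    rw [Real.mul_rpow hx.le ht.le, show x + x * t = x * (1 + t) by ring,
      Real.mul_rpow hx.le (by linarith), add_sub_cancel_right,
      show x ^ c = x ^ a * x ^ (c - a - 1) * x by
        rw [← Real.rpow_add hx, ← Real.rpow_add_one hx.ne']; ring_nf]
    ring
  rw [Real.Gamma_eq_integral hc0]
  refine Tendsto.congr' (f₁ := fun x =>
    ∫ u in Ioi (0 : ℝ), Real.exp (-u) * (u ^ a * (x + u) ^ (c - a - 1))) ?_ ?_
  · filter_upwards [self_mem_nhdsWithin] with x hx using hscale x hx
  have hpow : ∀ u : ℝ, 0 < u → u ^ (c - 1) = u ^ a * u ^ (c - a - 1) := fun u hu => by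
    rw [← Real.rpow_add hu]; ring_nf
  refine tendsto_integral_filter_of_dominated_convergence _
    (Eventually.of_forall fun y => Measurable.aestronglyMeasurable (by fun_prop)) ?_
    (Real.GammaIntegral_convergent hc0) ?_
  · filter_upwards [self_mem_nhdsWithin] with x hx
    have hx' : (0 : ℝ) < x := hx
    refine (ae_restrict_iff' measurableSet_Ioi).2 (ae_of_all _ fun t (ht : 0 < t) => ?_)
    rw [Real.norm_of_nonneg (by positivity), hpow t ht]
    refine mul_le_mul_of_nonneg_left (mul_le_mul_of_nonneg_left ?_ (by positivity))
      (by positivity)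
    exact Real.rpow_le_rpow_of_nonpos ht (by linarith) hq
  · refine (ae_restrict_iff' measurableSet_Ioi).2 (ae_of_all _ fun t (ht : 0 < t) => ?_)
    rw [hpow t ht]
    have h2 : ContinuousAt (fun x : ℝ => Real.exp (-t) * (t ^ a * (x + t) ^ (c - a - 1))) 0 := by
      have : ContinuousAt (fun x : ℝ => (x + t) ^ (c - a - 1)) 0 :=
        ContinuousAt.rpow_const (by fun_prop) (Or.inl (by simpa using ht.ne'))
      fun_prop
    have h3 := h2.tendsto
    rw [zero_add] at h3
    exact h3.mono_left nhdsWithin_le_nhds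

lemma continuous_inv_Gamma : Continuous fun s : ℝ => (Real.Gamma s)⁻¹ := by
  have h := Complex.continuous_re.comp
    (Complex.differentiable_one_div_Gamma.continuous.comp Complex.continuous_ofReal)
  refine h.congr fun s => ?_
  simp only [Function.comp_apply]
  rw [Complex.Gamma_ofReal, ← Complex.ofReal_inv, Complex.ofReal_re]

lemma inv_Gamma_eq_mul (s : ℝ) : (Real.Gamma s)⁻¹ = s * (Real.Gamma (s + 1))⁻¹ := by
  rcases eq_or_ne s 0 with rfl | hs
  · simp
  · rw [Real.Gamma_add_one hs, mul_inv, mul_inv_cancel_left₀ hs]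

/-- The real Tricomi function. -/
noncomputable def tricomi (a c x : ℝ) : ℝ :=
  Real.Gamma (1 - c) * (Real.Gamma (a - c + 1))⁻¹ * kummer a c x +
    Real.Gamma (c - 1) * (Real.Gamma a)⁻¹ * (x ^ (1 - c) * kummer (a - c + 1) (2 - c) x)

/-- The Euler derivative of the Tricomi function. -/
noncomputable def tricomiTheta (a c x : ℝ) : ℝ :=
  a * (a - c + 1) * tricomi (a + 1) c x - a * tricomi a c x

lemma tricomi_contiguous (a : ℝ) {c : ℝ} (hc0 : 0 < c) (hc2 : c < 2) (x : ℝ) :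
    tricomi a c x = (2 * (a + 1) - c + x) * tricomi (a + 1) c x
      - (a + 1) * (a - c + 2) * tricomi (a + 2) c x := by
  have h1 := kummer_contiguous (a + 1) hc0 x
  have h2 := kummer_contiguous (a - c + 2) (by linarith : 0 < 2 - c) x
  have g1 := inv_Gamma_eq_mul (a - c + 1)
  have g2 := inv_Gamma_eq_mul (a - c + 1 + 1)
  have g3 := inv_Gamma_eq_mul a
  have g4 := inv_Gamma_eq_mul (a + 1)
  rw [show a + 1 - 1 = a by ring, show a + 1 + 1 = a + 2 by ring] at h1
  rw [show a - c + 2 - 1 = a - c + 1 by ring, show a - c + 2 + 1 = a - c + 3 by ring] at h2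
  rw [show a - c + 1 + 1 = a - c + 2 by ring] at g1 g2
  rw [show a - c + 2 + 1 = a - c + 3 by ring] at g2
  rw [show a + 1 + 1 = a + 2 by ring] at g4
  simp only [tricomi]
  rw [show a + 1 - c + 1 = a - c + 2 by ring, show a + 2 - c + 1 = a - c + 3 by ring, g1, g2, g3, g4]
  linear_combination (-Real.Gamma (1 - c) * (a - c + 2) * (Real.Gamma (a - c + 3))⁻¹) * h1
    + (-Real.Gamma (c - 1) * (a + 1) * (Real.Gamma (a + 2))⁻¹ * x ^ (1 - c)) * h2

lemma isKummerSol_tricomi (a : ℝ) {c : ℝ} (hc0 : 0 < c) (hc2 : c < 2) :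
    IsKummerSol a c (tricomi a c) (tricomiTheta a c) := by
  have h := ((isKummerSol_kummer a hc0).const_mul
    (Real.Gamma (1 - c) * (Real.Gamma (a - c + 1))⁻¹)).add
    ((isKummerSol_kummer (a - c + 1) (by linarith : 0 < 2 - c)).rpow_mul.const_mul
      (Real.Gamma (c - 1) * (Real.Gamma a)⁻¹))
  convert h using 1
  · rfl
  · funext x
    simp only [tricomiTheta, tricomi]
    rw [show a + 1 - c + 1 = a - c + 1 + 1 by ring, inv_Gamma_eq_mul (a - c + 1),
      inv_Gamma_eq_mul a]
    ring

lemma tricomiTheta_eq (a : ℝ) {c : ℝ} (hc0 : 0 < c) (hc2 : c < 2) (x : ℝ) :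
    tricomiTheta a c x = Real.Gamma (1 - c) * (Real.Gamma (a - c + 1))⁻¹ *
        (x * (a / c * kummer (a + 1) (c + 1) x)) +
      Real.Gamma (c - 1) * (Real.Gamma a)⁻¹ * (x ^ (1 - c) *
        ((1 - c) * kummer (a - c + 1) (2 - c) x +
          x * ((a - c + 1) / (2 - c) * kummer (a - c + 1 + 1) (2 - c + 1) x))) := by
  have g1 := inv_Gamma_eq_mul (a - c + 1)
  have g3 := inv_Gamma_eq_mul a
  rw [kummer_raise a hc0, kummer_raise (a - c + 1) (by linarith : 0 < 2 - c)]
  simp only [tricomiTheta, tricomi]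
  rw [show a + 1 - c + 1 = a - c + 1 + 1 by ring, g1, g3]
  ring

lemma tendsto_tricomi_zero (a : ℝ) {c : ℝ} (hc0 : 0 < c) (hc1 : c < 1) :
    Tendsto (tricomi a c) (𝓝[>] 0)
      (𝓝 (Real.Gamma (1 - c) * (Real.Gamma (a - c + 1))⁻¹)) := by
  have h1 := tendsto_kummer_nhdsGT_zero a hc0
  have h2 := tendsto_kummer_nhdsGT_zero (a - c + 1) (by linarith : 0 < 2 - c)
  have h3 := tendsto_rpow_nhdsGT_zero (by linarith : 0 < 1 - c)
  have h := (h1.const_mul (Real.Gamma (1 - c) * (Real.Gamma (a - c + 1))⁻¹)).add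
    ((h3.mul h2).const_mul (Real.Gamma (c - 1) * (Real.Gamma a)⁻¹))
  rw [zero_mul, mul_zero, add_zero, mul_one] at h
  exact h

lemma tendsto_rpow_mul_tricomiTheta (a : ℝ) {c : ℝ} (hc0 : 0 < c) (hc2 : c < 2) :
    Tendsto (fun x => x ^ (c - 1) * tricomiTheta a c x) (𝓝[>] 0)
      (𝓝 ((1 - c) * (Real.Gamma (c - 1) * (Real.Gamma a)⁻¹))) := by
  have h1 := tendsto_kummer_nhdsGT_zero (a + 1) (by linarith : 0 < c + 1)
  have h2 := tendsto_kummer_nhdsGT_zero (a - c + 1) (by linarith : 0 < 2 - c)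
  have h3 := tendsto_kummer_nhdsGT_zero (a - c + 1 + 1) (by linarith : 0 < 2 - c + 1)
  have h4 := tendsto_rpow_nhdsGT_zero hc0
  have h5 : Tendsto (fun x : ℝ => x) (𝓝[>] 0) (𝓝 0) := nhdsWithin_le_nhds
  have h := ((h4.mul (h1.const_mul (a / c))).const_mul
      (Real.Gamma (1 - c) * (Real.Gamma (a - c + 1))⁻¹)).add
    (((h2.const_mul (1 - c)).add (h5.mul (h3.const_mul ((a - c + 1) / (2 - c))))).const_mul
      (Real.Gamma (c - 1) * (Real.Gamma a)⁻¹))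
  have h' := h.congr' (f₂ := fun x => x ^ (c - 1) * tricomiTheta a c x) (by
    filter_upwards [self_mem_nhdsWithin] with x hx
    have hx' : (0 : ℝ) < x := hx
    rw [tricomiTheta_eq a hc0 hc2, show 1 - c = -(c - 1) by ring, Real.rpow_neg hx'.le,
      show x ^ c = x ^ (c - 1) * x by rw [← Real.rpow_add_one hx'.ne']; ring_nf]
    have : x ^ (c - 1) ≠ 0 := by positivity
    field_simp)
  convert h' using 2
  ring

lemma Gamma_mul_tricomi {a c x : ℝ} (ha : 0 < a) (hc0 : 0 < c) (hc1 : c < 1) (hx : 0 < x) :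
    Real.Gamma a * tricomi a c x = tricomiIntegral a (c - a - 1) x := by
  have hG := (Real.Gamma_pos_of_pos ha).ne'
  have hs := (isKummerSol_tricomiIntegral (c := c) ha (by linarith)).add
    ((isKummerSol_tricomi a hc0 (by linarith)).const_mul (-Real.Gamma a))
  have h := hs.eq_zero ha hc0 ?_ ?_ hx
  · linear_combination -h
  · convert (tendsto_tricomiIntegral_zero ha hc1).add
      ((tendsto_tricomi_zero a hc0 hc1).const_mul (-Real.Gamma a)) using 2
    ring
  · have h1 := (tendsto_rpow_mul_tricomiIntegral (a := a) hc0 (by linarith)).neg.add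
      ((tendsto_rpow_mul_tricomiTheta a hc0 (by linarith)).const_mul (-Real.Gamma a))
    have hc : Real.Gamma c = (c - 1) * Real.Gamma (c - 1) := by
      rw [← Real.Gamma_add_one (by linarith : c - 1 ≠ 0), sub_add_cancel]
    have e : -Real.Gamma c + -Real.Gamma a * ((1 - c) * (Real.Gamma (c - 1) * (Real.Gamma a)⁻¹))
        = 0 := by
      rw [hc]; field_simp; ring
    rw [e] at h1
    refine h1.congr' ?_
    filter_upwards [self_mem_nhdsWithin] with x hx
    have hx' : (0 : ℝ) < x := hx
    rw [show x ^ c = x ^ (c - 1) * x by rw [← Real.rpow_add_one hx'.ne']; ring_nf]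
    ring

lemma exists_tricomi_le_pow {c : ℝ} (hc0 : 0 < c) (hc1 : c < 1) (k : ℕ) :
    ∀ L : ℝ, ∃ C, 0 ≤ C ∧ ∀ a, -(k : ℝ) < a → a ≤ L → ∀ x, 0 < x →
      |tricomi a c x| ≤ C * (1 + x) ^ k := by
  induction k with
  | zero =>
    intro L
    obtain ⟨C, hC⟩ := (isCompact_Icc (a := (0 : ℝ)) (b := L)).exists_bound_of_continuousOn
      (f := fun a => Real.Gamma (1 - c) * (Real.Gamma (a - c + 1))⁻¹)
      (continuous_const.mul (continuous_inv_Gamma.comp (by fun_prop))).continuousOn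
    refine ⟨max C 0, le_max_right _ _, fun a ha haL x hx => ?_⟩
    rw [Nat.cast_zero, neg_zero] at ha
    have hG := Real.Gamma_pos_of_pos ha
    have h := Gamma_mul_tricomi ha hc0 hc1 hx
    have h1 : tricomi a c x = tricomiIntegral a (c - a - 1) x / Real.Gamma a := by
      rw [← h]; field_simp
    have h2 := tricomiIntegral_le ha hc1 hx
    rw [h1, abs_of_nonneg (div_nonneg (tricomiIntegral_nonneg _ _ _) hG.le), pow_zero, mul_one]
    refine le_trans ?_ ((le_abs_self _).trans ((hC a ⟨ha.le, haL⟩).trans (le_max_left _ _)))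
    rw [div_le_iff₀ hG]
    calc _ ≤ Real.Gamma a * Real.Gamma (1 - c) / Real.Gamma (a - c + 1) := h2
      _ = _ := by ring
  | succ k ih =>
    intro L
    obtain ⟨C, hC0, hC⟩ := ih (L + 2)
    set B : ℝ := |L| + k + 1
    have hB : 0 ≤ B := by positivity
    refine ⟨C * ((2 * B + 3) + (B + 1) * (B + 3)), by positivity, fun a ha haL x hx => ?_⟩
    push_cast at ha
    have haB : |a| ≤ B := abs_le.2 ⟨by linarith [abs_nonneg L],
      by linarith [le_abs_self L, (Nat.cast_nonneg k : (0 : ℝ) ≤ k)]⟩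
    have h1 := hC (a + 1) (by linarith) (by linarith) x hx
    have h2 := hC (a + 2) (by linarith) (by linarith) x hx
    have b1 : |2 * (a + 1) - c + x| ≤ (2 * B + 3) * (1 + x) := by
      have := abs_le.1 haB
      refine abs_le.2 ⟨?_, ?_⟩ <;> nlinarith
    have b2 : |(a + 1) * (a - c + 2)| ≤ (B + 1) * (B + 3) := by
      have := abs_le.1 haB
      rw [abs_mul]
      gcongr <;> refine abs_le.2 ⟨?_, ?_⟩ <;> linarith
    rw [tricomi_contiguous a hc0 (by linarith)]
    calc _ ≤ |2 * (a + 1) - c + x| * |tricomi (a + 1) c x|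
          + |(a + 1) * (a - c + 2)| * |tricomi (a + 2) c x| := by
          rw [← abs_mul, ← abs_mul]; exact abs_sub _ _
      _ ≤ (2 * B + 3) * (1 + x) * (C * (1 + x) ^ k)
          + (B + 1) * (B + 3) * (C * (1 + x) ^ k * (1 + x)) := by
          gcongr
          refine h2.trans (le_mul_of_one_le_right (by positivity) (by linarith))
      _ = _ := by ring

lemma exists_tricomi_le_exp {c : ℝ} (hc0 : 0 < c) (hc1 : c < 1) (L : ℝ) :
    ∃ C, 0 ≤ C ∧ ∀ a, |a| ≤ L → ∀ x, 0 < x → |tricomi a c x| ≤ C * Real.exp (x / 4) := by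
  obtain ⟨k, hk⟩ := exists_nat_gt L
  obtain ⟨C, hC0, hC⟩ := exists_tricomi_le_pow hc0 hc1 k L
  refine ⟨C * (4 ^ k * (Nat.factorial k) * Real.exp (1 / 4)), by positivity,
    fun a ha x hx => ?_⟩
  have h := hC a (by linarith [neg_abs_le a]) (by linarith [le_abs_self a]) x hx
  have h2 := Real.pow_div_factorial_le_exp ((1 + x) / 4) (by positivity) k
  rw [div_pow, show (1 + x) / 4 = 1 / 4 + x / 4 by ring, Real.exp_add,
    div_le_iff₀ (by positivity), div_le_iff₀ (by positivity)] at h2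
  calc _ ≤ C * (1 + x) ^ k := h
    _ ≤ C * (Real.exp (1 / 4) * Real.exp (x / 4) * (Nat.factorial k) * 4 ^ k) := by gcongr
    _ = _ := by ring

lemma measurable_tricomi (a : ℝ) {c : ℝ} (hc0 : 0 < c) (hc2 : c < 2) : Measurable (tricomi a c) := by
  have h1 := (continuous_kummer a hc0).measurable
  have h2 := (continuous_kummer (a - c + 1) (by linarith : 0 < 2 - c)).measurable
  unfold tricomi
  fun_prop

lemma continuous_tricomi_left {c : ℝ} (hc0 : 0 < c) (hc2 : c < 2) (x : ℝ) :
    Continuous fun a => tricomi a c x := by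
  have h1 := continuous_kummer_left hc0 x
  have h2 := (continuous_kummer_left (by linarith : 0 < 2 - c) x).comp
    (by fun_prop : Continuous fun a : ℝ => a - c + 1)
  have h3 := continuous_inv_Gamma
  have h4 := continuous_inv_Gamma.comp (by fun_prop : Continuous fun a : ℝ => a - c + 1)
  exact ((continuous_const.mul h4).mul h1).add
    ((continuous_const.mul h3).mul (continuous_const.mul h2))

lemma tendsto_wronskian_tricomi (a b : ℝ) {c : ℝ} (hc0 : 0 < c) (hc2 : c < 2) :
    Tendsto (kummerWronskian c (tricomi a c) (tricomiTheta a c) (tricomi b c) (tricomiTheta b c))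
      (𝓝[>] 0) (𝓝 ((1 - c) * (Real.Gamma (1 - c) * Real.Gamma (c - 1)) *
        ((Real.Gamma a)⁻¹ * (Real.Gamma (b - c + 1))⁻¹
          - (Real.Gamma (a - c + 1))⁻¹ * (Real.Gamma b)⁻¹))) := by
  have hc2' : 0 < 2 - c := by linarith
  set Aa := Real.Gamma (1 - c) * (Real.Gamma (a - c + 1))⁻¹ with hAa
  set Ab := Real.Gamma (1 - c) * (Real.Gamma (b - c + 1))⁻¹ with hAb
  set Ba := Real.Gamma (c - 1) * (Real.Gamma a)⁻¹ with hBa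
  set Bb := Real.Gamma (c - 1) * (Real.Gamma b)⁻¹ with hBb
  let M : ℝ → ℝ → ℝ := fun a => kummer a c
  let N : ℝ → ℝ → ℝ := fun a => kummer (a - c + 1) (2 - c)
  let M' : ℝ → ℝ → ℝ := fun a x => a / c * kummer (a + 1) (c + 1) x
  let N' : ℝ → ℝ → ℝ := fun a x => (a - c + 1) / (2 - c) * kummer (a - c + 1 + 1) (2 - c + 1) x
  let G : ℝ → ℝ := fun x => Real.exp (-x) * (Aa * Ab * (x ^ c * (M' a x * M b x - M a x * M' b x))
    + Aa * Bb * (x * (M' a x * N b x) - M a x * ((1 - c) * N b x + x * N' b x))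
    + Ba * Ab * (((1 - c) * N a x + x * N' a x) * M b x - x * (N a x * M' b x))
    + Ba * Bb * (x ^ (2 - c) * (N' a x * N b x - N a x * N' b x)))
  have cM : ∀ a, Continuous (M a) := fun a => continuous_kummer a hc0
  have cN : ∀ a, Continuous (N a) := fun a => continuous_kummer _ hc2'
  have cM' : ∀ a, Continuous (M' a) := fun a =>
    continuous_const.mul (continuous_kummer _ (by linarith))
  have cN' : ∀ a, Continuous (N' a) := fun a =>
    continuous_const.mul (continuous_kummer _ (by linarith))
  have cp : Continuous fun x : ℝ => x ^ c := Real.continuous_rpow_const hc0.le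
  have cp2 : Continuous fun x : ℝ => x ^ (2 - c) := Real.continuous_rpow_const hc2'.le
  have hG : Continuous G := by
    have := cM a; have := cM b; have := cN a; have := cN b
    have := cM' a; have := cM' b; have := cN' a; have := cN' b
    fun_prop
  have h0 := (hG.tendsto 0).mono_left (nhdsWithin_le_nhds (s := Ioi 0))
  have hG0 : G 0 = (1 - c) * (Ba * Ab - Aa * Bb) := by
    simp only [G, M, N, kummer_zero, Real.zero_rpow hc0.ne', Real.zero_rpow hc2'.ne', neg_zero,
      Real.exp_zero]
    ring
  have hval : (1 - c) * (Real.Gamma (1 - c) * Real.Gamma (c - 1)) *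
        ((Real.Gamma a)⁻¹ * (Real.Gamma (b - c + 1))⁻¹
          - (Real.Gamma (a - c + 1))⁻¹ * (Real.Gamma b)⁻¹) = G 0 := by
    rw [hG0, hAa, hAb, hBa, hBb]
    ring
  rw [hval]
  refine h0.congr' ?_
  filter_upwards [self_mem_nhdsWithin] with x hx
  have hx' : (0 : ℝ) < x := hx
  have e1 : x ^ c = x ^ (c - 1) * x := by rw [← Real.rpow_add_one hx'.ne']; ring_nf
  have e2 : x ^ (1 - c) = (x ^ (c - 1))⁻¹ := by rw [← Real.rpow_neg hx'.le]; ring_nf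
  have e3 : x ^ (2 - c) = (x ^ (c - 1))⁻¹ * x := by
    rw [← e2, ← Real.rpow_add_one hx'.ne']; ring_nf
  have hz : x ^ (c - 1) ≠ 0 := by positivity
  simp only [kummerWronskian, G]
  rw [tricomiTheta_eq a hc0 hc2, tricomiTheta_eq b hc0 hc2, tricomi, tricomi, e1, e2, e3,
    ← hAa, ← hAb, ← hBa, ← hBb]
  simp only [M, N, M', N']
  field_simp
  ring

lemma integral_Ioi_of_hasDerivAt_of_tendsto_nhdsGT {f f' : ℝ → ℝ} {a l m : ℝ}
    (hderiv : ∀ x ∈ Ioi a, HasDerivAt f (f' x) x) (hf' : IntegrableOn f' (Ioi a))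
    (hl : Tendsto f (𝓝[>] a) (𝓝 l)) (hm : Tendsto f atTop (𝓝 m)) :
    ∫ x in Ioi a, f' x = m - l := by
  have h := integral_Ioi_of_hasDerivAt_of_tendsto (f := Function.update f a l) (f' := f')
    (a := a) (m := m) ?_ (fun x hx => ?_) hf' ?_
  · rwa [Function.update_self] at h
  · rw [continuousWithinAt_update_same, Ici_sdiff_left]
    exact hl
  · refine (hderiv x hx).congr_of_eventuallyEq ?_
    filter_upwards [isOpen_ne.mem_nhds (ne_of_gt hx)] with y hy
    exact Function.update_of_ne hy _ _
  · refine hm.congr' ?_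
    filter_upwards [eventually_ne_atTop a] with y hy
    exact (Function.update_of_ne hy _ _).symm

/-- The integrand of the weighted pairing of two Tricomi functions. -/
noncomputable def tricomiProd (a b c x : ℝ) : ℝ :=
  tricomi a c x * tricomi b c x * (x ^ (c - 1) * Real.exp (-x))

lemma tricomi_symm (a c : ℝ) {x : ℝ} (hx : 0 < x) :
    tricomi a c x = x ^ (1 - c) * tricomi (a - c + 1) (2 - c) x := by
  simp only [tricomi]
  rw [show a - c + 1 - (2 - c) + 1 = a by ring, show 2 - (2 - c) = c by ring,
    show 1 - (2 - c) = c - 1 by ring, show 2 - c - 1 = 1 - c by ring,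
    show x ^ (c - 1) = (x ^ (1 - c))⁻¹ by rw [← Real.rpow_neg hx.le]; ring_nf]
  have : x ^ (1 - c) ≠ 0 := by positivity
  field_simp
  ring

lemma tricomiProd_symm (a b c : ℝ) {x : ℝ} (hx : 0 < x) :
    tricomiProd a b c x = tricomiProd (a - c + 1) (b - c + 1) (2 - c) x := by
  rw [tricomiProd, tricomiProd, tricomi_symm a c hx, tricomi_symm b c hx,
    show 2 - c - 1 = 1 - c by ring,
    show x ^ (c - 1) = (x ^ (1 - c))⁻¹ by rw [← Real.rpow_neg hx.le]; ring_nf]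
  have : x ^ (1 - c) ≠ 0 := by positivity
  field_simp

lemma measurable_tricomiProd (a b : ℝ) {c : ℝ} (hc0 : 0 < c) (hc2 : c < 2) :
    Measurable (tricomiProd a b c) := by
  have h1 := measurable_tricomi a hc0 hc2
  have h2 := measurable_tricomi b hc0 hc2
  unfold tricomiProd
  fun_prop

lemma exists_tricomiProd_le {c : ℝ} (hc0 : 0 < c) (hc1 : c < 1) (L : ℝ) :
    ∃ C, ∀ a b, |a| ≤ L → |b| ≤ L → ∀ x, 0 < x →
      ‖tricomiProd a b c x‖ ≤ C * (x ^ (c - 1) * Real.exp (-(1 / 2 * x))) := by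
  obtain ⟨C, hC0, hC⟩ := exists_tricomi_le_exp hc0 hc1 L
  refine ⟨C * C, fun a b ha hb x hx => ?_⟩
  rw [tricomiProd, Real.norm_eq_abs, abs_mul, abs_mul,
    abs_of_nonneg (by positivity : 0 ≤ x ^ (c - 1) * Real.exp (-x))]
  calc _ ≤ C * Real.exp (x / 4) * (C * Real.exp (x / 4)) * (x ^ (c - 1) * Real.exp (-x)) := by
        gcongr
        exacts [hC a ha x hx, hC b hb x hx]
    _ = C * C * (x ^ (c - 1) * (Real.exp (x / 4) * Real.exp (x / 4) * Real.exp (-x))) := by ring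
    _ = _ := by
        rw [← Real.exp_add, ← Real.exp_add]
        ring_nf

lemma integrableOn_rpow_mul_exp_neg_half {c : ℝ} (hc0 : 0 < c) (C : ℝ) :
    IntegrableOn (fun x => C * (x ^ (c - 1) * Real.exp (-(1 / 2 * x)))) (Ioi 0) := by
  have h := (integrableOn_rpow_mul_exp_neg_mul hc0 (by norm_num : (0 : ℝ) < 1 / 2)).const_mul C
  exact h

lemma integrableOn_tricomiProd_of_lt_one (a b : ℝ) {c : ℝ} (hc0 : 0 < c) (hc1 : c < 1) :
    IntegrableOn (tricomiProd a b c) (Ioi 0) := by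
  obtain ⟨C, hC⟩ := exists_tricomiProd_le hc0 hc1 (max |a| |b|)
  refine (integrableOn_rpow_mul_exp_neg_half hc0 C).mono'
    (measurable_tricomiProd a b hc0 (by linarith)).aestronglyMeasurable ?_
  filter_upwards [ae_restrict_mem measurableSet_Ioi] with x hx
  exact hC a b (le_max_left _ _) (le_max_right _ _) x hx

lemma continuous_integral_tricomiProd_of_lt_one (a : ℝ) {c : ℝ} (hc0 : 0 < c) (hc1 : c < 1) :
    Continuous fun b => ∫ x in Ioi 0, tricomiProd a b c x := by
  refine continuous_iff_continuousAt.2 fun b => ?_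
  obtain ⟨C, hC⟩ := exists_tricomiProd_le hc0 hc1 (max |a| (|b| + 1))
  refine continuousAt_of_dominated (Eventually.of_forall fun b' =>
    (measurable_tricomiProd a b' hc0 (by linarith)).aestronglyMeasurable) ?_
    (integrableOn_rpow_mul_exp_neg_half hc0 C) (Eventually.of_forall fun x => ?_)
  · filter_upwards [Metric.ball_mem_nhds b one_pos] with b' hb'
    filter_upwards [ae_restrict_mem measurableSet_Ioi] with x hx
    refine hC a b' (le_max_left _ _) (le_trans ?_ (le_max_right _ _)) x hx
    have := abs_sub_abs_le_abs_sub b' b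
    rw [Metric.mem_ball, Real.dist_eq] at hb'
    linarith
  · have h := continuous_tricomi_left hc0 (by linarith) x
    unfold tricomiProd
    fun_prop

lemma integral_tricomiProd_of_lt_one (a b : ℝ) {c : ℝ} (hc0 : 0 < c) (hc1 : c < 1) :
    (a - b) * ∫ x in Ioi 0, tricomiProd a b c x =
      (1 - c) * (Real.Gamma (1 - c) * Real.Gamma (c - 1)) *
        ((Real.Gamma (a - c + 1))⁻¹ * (Real.Gamma b)⁻¹
          - (Real.Gamma a)⁻¹ * (Real.Gamma (b - c + 1))⁻¹) := by
  have hc2 : c < 2 := by linarith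
  have hfi := fun a b => integrableOn_tricomiProd_of_lt_one a b hc0 hc1
  have hW : IntegrableOn
      (kummerWronskian c (tricomi a c) (tricomiTheta a c) (tricomi b c) (tricomiTheta b c))
      (Ioi 0) := by
    have h := ((((hfi (a + 1) b).const_mul (a * (a - c + 1))).sub
      ((hfi a b).const_mul a)).sub ((hfi a (b + 1)).const_mul (b * (b - c + 1)))).add
      ((hfi a b).const_mul b)
    refine IntegrableOn.congr_fun h (fun x _ => ?_) measurableSet_Ioi
    simp only [kummerWronskian, tricomiTheta, tricomiProd, Pi.add_apply, Pi.sub_apply]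
    ring
  have hderiv : ∀ x ∈ Ioi (0 : ℝ), HasDerivAt
      (kummerWronskian c (tricomi a c) (tricomiTheta a c) (tricomi b c) (tricomiTheta b c))
      ((a - b) * tricomiProd a b c x) x := fun x hx =>
    (isKummerSol_tricomi a hc0 hc2).hasDerivAt_wronskian (isKummerSol_tricomi b hc0 hc2) hx
  have hfi' := (hfi a b).const_mul (a - b)
  have h := integral_Ioi_of_hasDerivAt_of_tendsto_nhdsGT hderiv hfi'
    (tendsto_wronskian_tricomi a b hc0 hc2)
    (tendsto_zero_of_hasDerivAt_of_integrableOn_Ioi hderiv hfi' hW)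
  rw [integral_const_mul] at h
  rw [h]
  ring

lemma integrableOn_tricomiProd (a b : ℝ) {c : ℝ} (hc0 : 0 < c) (hc2 : c < 2) (hc1 : c ≠ 1) :
    IntegrableOn (tricomiProd a b c) (Ioi 0) := by
  rcases hc1.lt_or_gt with h | h
  · exact integrableOn_tricomiProd_of_lt_one a b hc0 h
  · exact (integrableOn_tricomiProd_of_lt_one (a - c + 1) (b - c + 1)
      (by linarith : 0 < 2 - c) (by linarith)).congr_fun
      (fun x hx => (tricomiProd_symm a b c hx).symm) measurableSet_Ioi

lemma continuous_integral_tricomiProd (a : ℝ) {c : ℝ} (hc0 : 0 < c) (hc2 : c < 2) (hc1 : c ≠ 1) :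
    Continuous fun b => ∫ x in Ioi 0, tricomiProd a b c x := by
  rcases hc1.lt_or_gt with h | h
  · exact continuous_integral_tricomiProd_of_lt_one a hc0 h
  · refine ((continuous_integral_tricomiProd_of_lt_one (a - c + 1)
      (by linarith : 0 < 2 - c) (by linarith)).comp
      (by fun_prop : Continuous fun b : ℝ => b - c + 1)).congr fun b => ?_
    exact setIntegral_congr_fun measurableSet_Ioi fun x hx => (tricomiProd_symm a b c hx).symm

lemma integral_tricomiProd (a b : ℝ) {c : ℝ} (hc0 : 0 < c) (hc2 : c < 2) (hc1 : c ≠ 1) :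
    (a - b) * ∫ x in Ioi 0, tricomiProd a b c x =
      (1 - c) * (Real.Gamma (1 - c) * Real.Gamma (c - 1)) *
        ((Real.Gamma (a - c + 1))⁻¹ * (Real.Gamma b)⁻¹
          - (Real.Gamma a)⁻¹ * (Real.Gamma (b - c + 1))⁻¹) := by
  rcases hc1.lt_or_gt with h | h
  · exact integral_tricomiProd_of_lt_one a b hc0 h
  · have h1 := integral_tricomiProd_of_lt_one (a - c + 1) (b - c + 1)
      (by linarith : 0 < 2 - c) (by linarith)
    rw [setIntegral_congr_fun measurableSet_Ioi fun x hx => tricomiProd_symm a b c hx]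
    rw [show a - c + 1 - (2 - c) + 1 = a by ring, show b - c + 1 - (2 - c) + 1 = b by ring,
      show 1 - (2 - c) = c - 1 by ring, show 2 - c - 1 = 1 - c by ring] at h1
    linear_combination h1

lemma integral_eq_integral_Ioi_add {f g h : ℝ → ℝ} (hg : IntegrableOn g (Ioi 0))
    (hh : IntegrableOn h (Ioi 0)) (hfg : ∀ y, 0 < y → f y = g y)
    (hfh : ∀ y, 0 < y → f (-y) = h y) :
    ∫ y, f y = (∫ y in Ioi 0, g y) + ∫ y in Ioi 0, h y := by
  have h1 : IntegrableOn f (Ioi 0) := hg.congr_fun (fun y hy => (hfg y hy).symm) measurableSet_Ioi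
  have h2 : IntegrableOn f (Iic 0) := by
    rw [integrableOn_Iic_iff_integrableOn_Iio]
    have h3 := ((Measure.measurePreserving_neg (volume : Measure ℝ)).integrableOn_comp_preimage
      (Homeomorph.neg ℝ).measurableEmbedding).2 hh
    simp only [Set.neg_preimage, neg_Ioi, neg_zero] at h3
    refine h3.congr_fun (fun y hy => ?_) measurableSet_Iio
    rw [Function.comp_apply, ← hfh (-y) (neg_pos.2 hy), neg_neg]
  have h3 := integral_comp_neg_Ioi (0 : ℝ) f
  rw [neg_zero] at h3
  rw [← intervalIntegral.integral_Iic_add_Ioi h2 h1, ← h3, add_comm,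
    setIntegral_congr_fun measurableSet_Ioi hfg, setIntegral_congr_fun measurableSet_Ioi hfh]

lemma inv_Gamma_mul_inv_Gamma_one_sub (s : ℝ) :
    (Real.Gamma s)⁻¹ * (Real.Gamma (1 - s))⁻¹ = Real.sin (Real.pi * s) / Real.pi := by
  rw [← mul_inv, Real.Gamma_mul_Gamma_one_sub, inv_div]

/-- The weighted inner product of the perturbed Laguerre functions with indices `n` and `n + s`,
where the shift `s` is allowed to be any real number. -/
noncomputable def laguerrePairing (α β : ℝ) (n : ℤ) (s : ℝ) : ℝ :=
  Real.cos (Real.pi * β) * ((Real.Gamma (1 / 2 - n - α))⁻¹ * (Real.Gamma (1 / 2 - n - α - s))⁻¹) *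
      (∫ x in Ioi 0, tricomiProd (1 / 2 + n + β) (1 / 2 + n + β + s) (1 - α + β) x) +
    Real.cos (Real.pi * α) * ((Real.Gamma (1 / 2 + n + β))⁻¹ * (Real.Gamma (1 / 2 + n + β + s))⁻¹) *
      ∫ x in Ioi 0, tricomiProd (1 / 2 - n - α) (1 / 2 - n - α - s) (1 - α + β) x

lemma continuous_laguerrePairing {α β : ℝ} (h : |α - β| < 1) (hne : α ≠ β) (n : ℤ) :
    Continuous (laguerrePairing α β n) := by
  obtain ⟨h1, h2⟩ := abs_lt.1 h
  have hc0 : 0 < 1 - α + β := by linarith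
  have hc2 : 1 - α + β < 2 := by linarith
  have hc1 : 1 - α + β ≠ 1 := fun h => hne (by linarith)
  have c1 := (continuous_integral_tricomiProd (1 / 2 + n + β) hc0 hc2 hc1).comp
    (by fun_prop : Continuous fun s : ℝ => 1 / 2 + n + β + s)
  have c2 := (continuous_integral_tricomiProd (1 / 2 - n - α) hc0 hc2 hc1).comp
    (by fun_prop : Continuous fun s : ℝ => 1 / 2 - n - α - s)
  have c3 := continuous_inv_Gamma.comp (by fun_prop : Continuous fun s : ℝ => 1 / 2 + n + β + s)
  have c4 := continuous_inv_Gamma.comp (by fun_prop : Continuous fun s : ℝ => 1 / 2 - n - α - s)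
  exact ((continuous_const.mul (continuous_const.mul c4)).mul c1).add
    ((continuous_const.mul (continuous_const.mul c3)).mul c2)

lemma sin_pi_mul_half_add (n : ℤ) (x : ℝ) :
    Real.sin (Real.pi * (1 / 2 + n + x)) = (-1) ^ n * Real.cos (Real.pi * x) := by
  rw [← Real.cos_add_int_mul_pi, ← Real.sin_add_pi_div_two]
  ring_nf

lemma sin_pi_mul_half_sub (n : ℤ) (x : ℝ) :
    Real.sin (Real.pi * (1 / 2 - n - x)) = (-1) ^ n * Real.cos (Real.pi * x) := by
  rw [← Real.cos_add_int_mul_pi, ← Real.sin_pi_div_two_sub]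
  ring_nf

lemma mul_laguerrePairing {α β : ℝ} (h : |α - β| < 1) (hne : α ≠ β) (n : ℤ) (s : ℝ) :
    s * laguerrePairing α β n s = (-1) ^ n * Real.sin (Real.pi * s) *
      ((Real.Gamma (1 / 2 + n + β))⁻¹ * (Real.Gamma (1 / 2 - n - α))⁻¹) := by
  obtain ⟨h1, h2⟩ := abs_lt.1 h
  have hc0 : 0 < 1 - α + β := by linarith
  have hc2 : 1 - α + β < 2 := by linarith
  have hc1 : 1 - α + β ≠ 1 := fun h => hne (by linarith)
  have hs0 : Real.sin (Real.pi * (α - β)) ≠ 0 := by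
    rw [Ne, Real.sin_eq_zero_iff_of_lt_of_lt (by nlinarith [Real.pi_pos])
      (by nlinarith [Real.pi_pos])]
    exact mul_ne_zero Real.pi_ne_zero (sub_ne_zero.2 hne)
  have hκ : (1 - (1 - α + β)) * (Real.Gamma (1 - (1 - α + β)) * Real.Gamma (1 - α + β - 1)) =
      -(Real.pi / Real.sin (Real.pi * (α - β))) := by
    have e := Real.Gamma_mul_Gamma_one_sub (α - β)
    have e2 := Real.Gamma_add_one (s := 1 - α + β - 1) (sub_ne_zero.2 hc1)
    rw [show 1 - α + β - 1 + 1 = 1 - (α - β) by ring] at e2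
    rw [← e, e2]
    ring_nf
  have i1 := integral_tricomiProd (1 / 2 + n + β) (1 / 2 + n + β + s) hc0 hc2 hc1
  have i2 := integral_tricomiProd (1 / 2 - n - α) (1 / 2 - n - α - s) hc0 hc2 hc1
  rw [hκ] at i1 i2
  have r1 := inv_Gamma_mul_inv_Gamma_one_sub (1 / 2 + n + β)
  have r2 := inv_Gamma_mul_inv_Gamma_one_sub (1 / 2 - n - α)
  have r3 := inv_Gamma_mul_inv_Gamma_one_sub (1 / 2 + n + (β + s))
  have r4 := inv_Gamma_mul_inv_Gamma_one_sub (1 / 2 - n - (α + s))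
  rw [sin_pi_mul_half_add] at r1 r3
  rw [sin_pi_mul_half_sub] at r2 r4
  have hsin : Real.cos (Real.pi * β) * Real.cos (Real.pi * (α + s)) -
      Real.cos (Real.pi * α) * Real.cos (Real.pi * (β + s)) =
      -(Real.sin (Real.pi * s) * Real.sin (Real.pi * (α - β))) := by
    simp only [mul_add, mul_sub, Real.cos_add, Real.sin_sub]
    ring
  rw [show 1 / 2 + n + β - (1 - α + β) + 1 = 1 - (1 / 2 - n - α) by ring,
    show 1 / 2 + n + β + s - (1 - α + β) + 1 = 1 - (1 / 2 - n - (α + s)) by ring,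
    show 1 / 2 + n + β + s = 1 / 2 + n + (β + s) by ring] at i1
  rw [show 1 / 2 - n - α - (1 - α + β) + 1 = 1 - (1 / 2 + n + β) by ring,
    show 1 / 2 - n - α - s - (1 - α + β) + 1 = 1 - (1 / 2 + n + (β + s)) by ring,
    show 1 / 2 - n - α - s = 1 / 2 - n - (α + s) by ring] at i2
  rw [laguerrePairing, show 1 / 2 + n + β + s = 1 / 2 + n + (β + s) by ring,
    show 1 / 2 - n - α - s = 1 / 2 - n - (α + s) by ring]
  generalize (∫ x in Ioi 0, tricomiProd (1 / 2 + n + β) (1 / 2 + n + (β + s)) (1 - α + β) x) = J₁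
    at *
  generalize (∫ x in Ioi 0, tricomiProd (1 / 2 - n - α) (1 / 2 - n - (α + s)) (1 - α + β) x) = J₂
    at *
  generalize (Real.Gamma (1 / 2 + n + β))⁻¹ = A at *
  generalize (Real.Gamma (1 / 2 - n - α))⁻¹ = D at *
  generalize (Real.Gamma (1 / 2 + n + (β + s)))⁻¹ = A' at *
  generalize (Real.Gamma (1 / 2 - n - (α + s)))⁻¹ = D' at *
  generalize (Real.Gamma (1 - (1 / 2 + n + β)))⁻¹ = A₁ at *
  generalize (Real.Gamma (1 - (1 / 2 - n - α)))⁻¹ = D₁ at *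
  generalize (Real.Gamma (1 - (1 / 2 + n + (β + s))))⁻¹ = A₁' at *
  generalize (Real.Gamma (1 - (1 / 2 - n - (α + s))))⁻¹ = D₁' at *
  have hpi := Real.pi_ne_zero
  generalize hS : Real.sin (Real.pi * (α - β)) = S at *
  have hκ' : Real.pi / S * S / Real.pi = 1 := by field_simp
  generalize hK : Real.pi / S = K at *
  have e1 : K * (-1) ^ n * (A * D) / Real.pi *
      -(Real.sin (Real.pi * s) * S) = -((-1) ^ n * Real.sin (Real.pi * s) * (A * D)) := by
    linear_combination (-((-1) ^ n * Real.sin (Real.pi * s) * (A * D))) * hκ'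
  rw [← hsin] at e1
  linear_combination (-Real.cos (Real.pi * β) * D * D') * i1 +
    (Real.cos (Real.pi * α) * A * A') * i2 - e1 -
    K * D * A * Real.cos (Real.pi * β) * r4 + K * D' * A' * Real.cos (Real.pi * β) * r2
    - K * A' * D' * Real.cos (Real.pi * α) * r1 + K * A * D * Real.cos (Real.pi * α) * r3

lemma laguerrePairing_zero {α β : ℝ} (h : |α - β| < 1) (hne : α ≠ β) (n : ℤ) :
    laguerrePairing α β n 0 = (-1) ^ n * Real.pi *
      ((Real.Gamma (1 / 2 + n + β))⁻¹ * (Real.Gamma (1 / 2 - n - α))⁻¹) := by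
  have hd : HasDerivAt (fun s => s * laguerrePairing α β n s)
      ((-1) ^ n * Real.pi *
        ((Real.Gamma (1 / 2 + n + β))⁻¹ * (Real.Gamma (1 / 2 - n - α))⁻¹)) 0 := by
    simp only [mul_laguerrePairing h hne]
    have h1 := ((hasDerivAt_id (0 : ℝ)).const_mul Real.pi).sin
    refine ((h1.const_mul ((-1) ^ n)).mul_const _).congr_deriv ?_
    simp
  have ht := hasDerivAt_iff_tendsto_slope.1 hd
  refine tendsto_nhds_unique (((continuous_laguerrePairing h hne n).tendsto 0).mono_left
    nhdsWithin_le_nhds) (ht.congr' ?_)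
  filter_upwards [self_mem_nhdsWithin] with s hs
  rw [slope_def_field, zero_mul, sub_zero, sub_zero, mul_div_cancel_left₀ _ hs]

lemma M11_ofReal (a c x : ℝ) : M11 a c x = (kummer a c x : ℂ) := by
  rw [M11, kummer, Complex.ofReal_tsum]
  refine tsum_congr fun k => ?_
  simp only [poch, kummerCoeff, Finset.prod_div_distrib]
  push_cast
  rw [div_div]

lemma Psi_ofReal (a c : ℝ) {x : ℝ} (hx : 0 < x) : Psi a c x = (tricomi a c x : ℂ) := by
  have e1 : Complex.exp ((1 - (c : ℂ)) * Real.log x) = ((x ^ (1 - c) : ℝ) : ℂ) := by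
    rw [Real.rpow_def_of_pos hx, mul_comm]
    push_cast
    rfl
  have e2 : M11 ((a : ℂ) - c + 1) (2 - c) x = (kummer (a - c + 1) (2 - c) x : ℂ) := by
    rw [← M11_ofReal]
    push_cast
    rfl
  rw [Psi, tricomi, e1, e2, M11_ofReal]
  push_cast
  simp only [← Complex.Gamma_ofReal]
  push_cast
  ring

/-- The real-valued version of `Lag`. -/
noncomputable def realLag (α β : ℝ) (n : ℤ) (y : ℝ) : ℝ :=
  if 0 < y then (Real.Gamma (1 / 2 - n - α))⁻¹ * tricomi (1 / 2 + n + β) (1 - α + β) y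
  else (Real.Gamma (1 / 2 + n + β))⁻¹ * tricomi (1 / 2 - n - α) (1 - α + β) (-y)

lemma Lag_eq_ofReal (α β : ℝ) (n : ℤ) {y : ℝ} (hy : y ≠ 0) :
    Lag α β n y = (realLag α β n y : ℂ) := by
  rw [Lag, realLag]
  split_ifs with h
  · push_cast
    rw [← Psi_ofReal _ _ h, ← Complex.Gamma_ofReal]
    push_cast
    rfl
  · push_cast
    rw [← Psi_ofReal _ _ (neg_pos.2 (lt_of_le_of_ne (not_lt.1 h) hy)), ← Complex.Gamma_ofReal]
    push_cast
    rfl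

lemma integral_Lag_mul {α β : ℝ} (h : |α - β| < 1) (hne : α ≠ β) (m n : ℤ) :
    ∫ y : ℝ, Lag α β n y * (starRingEnd ℂ) (Lag α β m y) * (muW α β y : ℂ) =
      (laguerrePairing α β n (m - n) : ℂ) := by
  obtain ⟨h1, h2⟩ := abs_lt.1 h
  have hc0 : 0 < 1 - α + β := by linarith
  have hc2 : 1 - α + β < 2 := by linarith
  have hc1 : 1 - α + β ≠ 1 := fun h => hne (by linarith)
  have hae : ∀ᵐ y : ℝ, Lag α β n y * (starRingEnd ℂ) (Lag α β m y) * (muW α β y : ℂ) =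
      ((realLag α β n y * realLag α β m y * muW α β y : ℝ) : ℂ) := by
    filter_upwards [compl_mem_ae_iff.2 (measure_singleton (0 : ℝ))] with y hy
    rw [Lag_eq_ofReal α β n hy, Lag_eq_ofReal α β m hy, Complex.conj_ofReal]
    push_cast
    rfl
  rw [integral_congr_ae hae, integral_complex_ofReal, integral_eq_integral_Ioi_add
    ((integrableOn_tricomiProd (1 / 2 + n + β) (1 / 2 + m + β) hc0 hc2 hc1).const_mul
      (Real.cos (Real.pi * β) *
        ((Real.Gamma (1 / 2 - n - α))⁻¹ * (Real.Gamma (1 / 2 - m - α))⁻¹)))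
    ((integrableOn_tricomiProd (1 / 2 - n - α) (1 / 2 - m - α) hc0 hc2 hc1).const_mul
      (Real.cos (Real.pi * α) *
        ((Real.Gamma (1 / 2 + n + β))⁻¹ * (Real.Gamma (1 / 2 + m + β))⁻¹)))]
  · rw [integral_const_mul, integral_const_mul, laguerrePairing,
      show 1 / 2 + n + β + ((m : ℝ) - n) = 1 / 2 + m + β by ring,
      show 1 / 2 - n - α - ((m : ℝ) - n) = 1 / 2 - m - α by ring]
  · intro y hy
    simp only [realLag, muW, if_pos hy, abs_of_pos hy, tricomiProd]
    rw [show 1 - α + β - 1 = β - α by ring]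
    ring
  · intro y hy
    simp only [realLag, muW, if_neg (not_lt.2 (neg_nonpos.2 hy.le)), abs_neg, neg_neg,
      abs_of_pos hy, tricomiProd]
    rw [show 1 - α + β - 1 = β - α by ring]
    ring

end

/-- Proposition A.2: orthogonality relations and norms of the perturbed Laguerre
system `𝓛_n^{α,β}` with respect to the (signed) weight `μ_{α,β}(y) dy`. -/
theorem stmt9 (α β : ℝ) (h1 : |α - β| < 1/2) (h2 : α ≠ β)
    (h3 : α ≠ 1/2) (h4 : α ≠ -(1/2)) (h5 : β ≠ 1/2) (h6 : β ≠ -(1/2)) :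
    (∀ m n : ℤ, m ≠ n →
      ∫ y : ℝ, Lag α β n y * (starRingEnd ℂ) (Lag α β m y) * (muW α β y : ℂ) = 0) ∧
    (∀ n : ℤ,
      ∫ y : ℝ, Lag α β n y * (starRingEnd ℂ) (Lag α β n y) * (muW α β y : ℂ)
        = (((-1 : ℝ) ^ n * Real.pi /
            (Real.Gamma (1/2 + n + β) * Real.Gamma (1/2 - n - α)) : ℝ) : ℂ)) := by
  have h : |α - β| < 1 := by linarith
  refine ⟨fun m n hmn => ?_, fun n => ?_⟩
  · have hs : (m : ℝ) - n ≠ 0 := sub_ne_zero.2 (by exact_mod_cast hmn)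
    have hz := mul_laguerrePairing h h2 n (m - n)
    rw [show Real.pi * ((m : ℝ) - n) = ((m - n : ℤ) : ℝ) * Real.pi by push_cast; ring,
      Real.sin_int_mul_pi, mul_zero, zero_mul, mul_eq_zero, or_iff_right hs] at hz
    rw [integral_Lag_mul h h2, hz, Complex.ofReal_zero]
  · rw [integral_Lag_mul h h2, sub_self, laguerrePairing_zero h h2, ← mul_inv, ← div_eq_mul_inv]
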